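/- Let 𝔐 = (V, ⟨·,·⟩, R) be a Riemannian model. Then 𝔐 is orthogonally Jacobi–Tsankov if and only if one of the following holds: (a) R = R_c for some c ∈ ℝ (constant sectional curvature), or (b) dim V is even and R = c·R_Θ for some c ∈ ℝ, where Θ is a Hermitian almost complex structure on (V, ⟨·,·⟩), i.e. Θ : V → V is linear with Θ² = −id and ⟨Θx, Θy⟩ = ⟨x,y⟩ for all x,y. -/

import Mathlib

/-- An eigenbasis of an operator that is self-adjoint for a positive definite symmetric form. -/
theorem exists_eigenbasis_of_selfAdjoint {V : Type*} [AddCommGroup V] [Module ℝ V]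
    [FiniteDimensional ℝ V] (B : V →ₗ[ℝ] V →ₗ[ℝ] ℝ) (hBsymm : ∀ x y, B x y = B y x)
    (hBpos : ∀ x, x ≠ 0 → 0 < B x x) (T : V →ₗ[ℝ] V) (hT : ∀ x y, B (T x) y = B x (T y)) :
    ∃ (b : Module.Basis (Fin (Module.finrank ℝ V)) ℝ V) (μ : Fin (Module.finrank ℝ V) → ℝ),
      ∀ i, T (b i) = μ i • b i := by
  let core : InnerProductSpace.Core ℝ V :=
    { inner := fun x y => B x y
      conj_inner_symm := fun x y => hBsymm y x
      re_inner_nonneg := fun x => by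
        rcases eq_or_ne x 0 with rfl | hx
        · simp
        · simpa using (hBpos x hx).le
      add_left := fun x y z => by simp
      smul_left := fun x y r => by simp
      definite := fun x hx => by
        by_contra hne
        exact (hBpos x hne).ne' hx }
  let _ : NormedAddCommGroup V := core.toNormedAddCommGroup
  let _ : InnerProductSpace ℝ V := InnerProductSpace.ofCore core.toCore
  have hS : T.IsSymmetric := fun x y => hT x y
  exact ⟨(hS.eigenvectorBasis rfl).toBasis, hS.eigenvalues rfl, fun i => by
    simp [hS.apply_eigenvectorBasis rfl i]⟩

/-- A Riemannian model together with its Jacobi operators. -/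
structure IsRiemannianModel {V : Type*} [AddCommGroup V] [Module ℝ V]
    (B : V →ₗ[ℝ] V →ₗ[ℝ] ℝ) (R : V →ₗ[ℝ] V →ₗ[ℝ] V →ₗ[ℝ] V →ₗ[ℝ] ℝ)
    (J : V → V →ₗ[ℝ] V) : Prop where
  form_symm : ∀ x y, B x y = B y x
  form_pos : ∀ x, x ≠ 0 → 0 < B x x
  skew : ∀ x y z w, R x y z w = -R y x z w
  pair_symm : ∀ x y z w, R x y z w = R z w x y
  bianchi : ∀ x y z w, R x y z w + R y z x w + R z x y w = 0
  jacobi : ∀ x y z, B (J x y) z = R y x x z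

/-- Jacobi operators of orthogonal vectors commute. -/
def IsOrthogonallyJacobiTsankov {V : Type*} [AddCommGroup V] [Module ℝ V]
    (B : V →ₗ[ℝ] V →ₗ[ℝ] ℝ) (J : V → V →ₗ[ℝ] V) : Prop :=
  ∀ x y, B x y = 0 → (J x) ∘ₗ (J y) = (J y) ∘ₗ (J x)

/-- The polarization of the Jacobi operator, `2 J(x, y)` in the usual notation. -/
def polarJacobi {V : Type*} [AddCommGroup V] [Module ℝ V] (J : V → V →ₗ[ℝ] V) (x y : V) :
    V →ₗ[ℝ] V :=
  J (x + y) - J x - J y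

namespace IsRiemannianModel

variable {V : Type*} [AddCommGroup V] [Module ℝ V] {B : V →ₗ[ℝ] V →ₗ[ℝ] ℝ}
  {R : V →ₗ[ℝ] V →ₗ[ℝ] V →ₗ[ℝ] V →ₗ[ℝ] ℝ} {J : V → V →ₗ[ℝ] V}

theorem eq_zero_of_form_self (M : IsRiemannianModel B R J) {x : V} (h : B x x = 0) : x = 0 := by
  by_contra hx
  exact (M.form_pos x hx).ne' h

theorem ext_form (M : IsRiemannianModel B R J) {u v : V} (h : ∀ w, B u w = B v w) : u = v := by
  refine sub_eq_zero.1 (M.eq_zero_of_form_self ?_)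
  rw [map_sub B, LinearMap.sub_apply, h, sub_self]

theorem skew_right (M : IsRiemannianModel B R J) (x y z w : V) : R x y z w = -R x y w z := by
  rw [M.pair_symm, M.skew, M.pair_symm w]

theorem apply_self_left (M : IsRiemannianModel B R J) (x z w : V) : R x x z w = 0 := by
  linarith [M.skew x x z w]

theorem jacobi_self (M : IsRiemannianModel B R J) (x : V) : J x x = 0 :=
  M.ext_form fun w => by simp [M.jacobi, M.apply_self_left]

theorem jacobi_zero (M : IsRiemannianModel B R J) (z : V) : J 0 z = 0 :=
  M.ext_form fun w => by simp [M.jacobi]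

theorem jacobi_symm (M : IsRiemannianModel B R J) (x y z : V) :
    B (J x y) z = B (J x z) y := by
  rw [M.jacobi, M.jacobi, M.pair_symm, M.skew, M.skew_right, neg_neg]

theorem jacobi_swap (M : IsRiemannianModel B R J) (x y : V) :
    B (J x y) y = B (J y x) x := by
  rw [M.jacobi, M.jacobi, M.skew, M.skew_right, neg_neg]

theorem form_polarJacobi (M : IsRiemannianModel B R J) (x y z w : V) :
    B (polarJacobi J x y z) w = R z x y w + R z y x w := by
  simp only [polarJacobi, LinearMap.sub_apply, map_sub, M.jacobi, map_add, LinearMap.add_apply]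
  ring

theorem jacobi_smul (M : IsRiemannianModel B R J) (t : ℝ) (x z : V) :
    J (t • x) z = t ^ 2 • J x z :=
  M.ext_form fun w => by
    simp only [M.jacobi, map_smul, LinearMap.smul_apply, smul_eq_mul]; ring

theorem jacobi_add_smul (M : IsRiemannianModel B R J) (s t : ℝ) (x y z : V) :
    J (s • x + t • y) z = s ^ 2 • J x z + (s * t) • polarJacobi J x y z + t ^ 2 • J y z :=
  M.ext_form fun w => by
    simp only [M.jacobi, M.form_polarJacobi, map_add, map_smul, LinearMap.smul_apply,
      LinearMap.add_apply, smul_eq_mul]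
    ring

theorem polarJacobi_symm (M : IsRiemannianModel B R J) (x y z w : V) :
    B (polarJacobi J x y z) w = B (polarJacobi J x y w) z := by
  simp only [polarJacobi, LinearMap.sub_apply, map_sub]
  rw [M.jacobi_symm, M.jacobi_symm x, M.jacobi_symm y]

theorem polarJacobi_comm (x y : V) : polarJacobi J x y = polarJacobi J y x := by
  simp only [polarJacobi, add_comm]; abel

theorem polarJacobi_left (M : IsRiemannianModel B R J) (x y : V) :
    polarJacobi J x y x = -J x y :=
  M.ext_form fun w => by
    simp only [M.jacobi, M.form_polarJacobi, map_neg, LinearMap.neg_apply]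
    linarith [M.skew x y x w, M.apply_self_left x y w]

theorem polarJacobi_right (M : IsRiemannianModel B R J) (x y : V) :
    polarJacobi J x y y = -J y x := by
  rw [polarJacobi_comm, M.polarJacobi_left]

theorem jacobi_comm (hJ : IsOrthogonallyJacobiTsankov B J) {x y : V} (h : B x y = 0) (z : V) :
    J x (J y z) = J y (J x z) :=
  LinearMap.congr_fun (hJ x y h) z

theorem polarJacobi_jacobi_comm (hJ : IsOrthogonallyJacobiTsankov B J)
    {x x' y : V} (h : B x y = 0) (h' : B x' y = 0) (z : V) :
    polarJacobi J x x' (J y z) = J y (polarJacobi J x x' z) := by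
  have h'' : B (x + x') y = 0 := by simp [h, h']
  simp only [polarJacobi, LinearMap.sub_apply, map_sub, jacobi_comm hJ h, jacobi_comm hJ h',
    jacobi_comm hJ h'']

theorem form_eq_zero_of_eigen (M : IsRiemannianModel B R J) {y a : V} {l : ℝ}
    (ha : J y a = l • a) (hl : l ≠ 0) : B a y = 0 := by
  have h := M.jacobi_symm y a y
  rw [M.jacobi_self, ha] at h
  simpa [hl] using h

theorem form_eq_zero_of_eigen_ne (M : IsRiemannianModel B R J) {y a b : V} {l m : ℝ}
    (ha : J y a = l • a) (hb : J y b = m • b) (hlm : m ≠ l) : B a b = 0 := by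
  have h := M.jacobi_symm y a b
  rw [ha, hb] at h
  simp only [map_smul, LinearMap.smul_apply, smul_eq_mul, M.form_symm b a] at h
  have : (l - m) * B a b = 0 := by linarith
  exact (mul_eq_zero.1 this).resolve_left (sub_ne_zero.2 hlm.symm)

/-- Eigenvectors of Jacobi operators are reciprocal. -/
theorem jacobi_duality (M : IsRiemannianModel B R J) (hJ : IsOrthogonallyJacobiTsankov B J)
    {y a : V} {l : ℝ} (hy : y ≠ 0) (ha : J y a = l • a) (hl : l ≠ 0) :
    J a y = (l * B a a / B y y) • y := by
  have hay := M.form_eq_zero_of_eigen ha hl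
  have hya : B y a = 0 := by rw [M.form_symm, hay]
  have hY := M.form_pos y hy
  set Y := B y y with hYdef
  set A := B a a with hAdef
  set u := J a y with hu
  have hA : 0 ≤ A := by
    rcases eq_or_ne a 0 with h | h
    · simp [hAdef, h]
    · exact (M.form_pos a h).le
  have key : ∀ t : ℝ, J ((-(t * A)) • y + Y • a) (l • a - t • u) = 0 := by
    intro t
    have horth : B ((-(t * A)) • y + Y • a) ((1 : ℝ) • y + t • a) = 0 := by
      simp only [map_add, map_smul, LinearMap.add_apply, LinearMap.smul_apply, smul_eq_mul,
        hay, hya, ← hYdef, ← hAdef]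
      ring
    have hcomm := jacobi_comm hJ horth ((-(t * A)) • y + Y • a)
    rw [M.jacobi_self ((-(t * A)) • y + Y • a), map_zero] at hcomm
    have hx : J ((1 : ℝ) • y + t • a) ((-(t * A)) • y + Y • a)
        = (Y + t ^ 2 * A) • (l • a - t • u) := by
      rw [M.jacobi_add_smul]
      simp only [map_add, map_smul, M.jacobi_self, M.polarJacobi_left, M.polarJacobi_right, ha,
        ← hu]
      module
    rw [hx, map_smul] at hcomm
    exact (smul_eq_zero.1 hcomm).resolve_left (by positivity)
  have hyu : J y u = 0 := by
    rw [hu, ← jacobi_comm hJ hay, M.jacobi_self, map_zero]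
  have h1 := key 1
  have h2 := key (-1)
  rw [M.jacobi_add_smul] at h1 h2
  simp only [map_sub, map_smul, hyu, ha, M.polarJacobi_right, M.jacobi_self, ← hu] at h1 h2
  have hau : Y • J a u = (A * l) • u := by
    have : (2 * Y) • (Y • J a u - (A * l) • u) = 0 := by
      linear_combination (norm := module) h2 - h1
    exact sub_eq_zero.1 ((smul_eq_zero.1 this).resolve_left (by positivity))
  have huy : B u y = l * A := by
    rw [hu, M.jacobi_swap, ha]; simp [hAdef]
  have huu : Y * B u u = A * l * (l * A) := by
    have h3 : B u u = B (J a u) y := M.jacobi_symm a y u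
    have h4 := congrArg (fun v => B v y) hau
    simp only [map_smul, LinearMap.smul_apply, smul_eq_mul, huy] at h4
    rw [h3, h4]
  refine sub_eq_zero.1 (M.eq_zero_of_form_self ?_)
  simp only [map_sub, map_smul, LinearMap.sub_apply, LinearMap.smul_apply, smul_eq_mul,
    M.form_symm y u, huy, ← hYdef]
  field_simp
  linear_combination huu

/-- If `a`, `b` are eigenvectors of `J y` with distinct eigenvalues, the first nonzero,
and `b` is orthogonal to `y`, then `J a b = 0`. -/
theorem jacobi_apply_eq_zero (M : IsRiemannianModel B R J) (hJ : IsOrthogonallyJacobiTsankov B J)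
    {y a b : V} {l m : ℝ} (hy : y ≠ 0) (ha : J y a = l • a) (hl : l ≠ 0)
    (hb : J y b = m • b) (hml : m ≠ l) (hby : B b y = 0) : J a b = 0 := by
  have hay := M.form_eq_zero_of_eigen ha hl
  have hY := M.form_pos y hy
  have horth : ∀ c, B c y = 0 → B (J a b) c = 0 := by
    intro c hc
    have h1 : B (J a b) c = -B (polarJacobi J a c a) b := by
      rw [M.polarJacobi_left, M.jacobi_symm]; simp
    have h2 := polarJacobi_jacobi_comm hJ hay hc a
    have h3 := M.jacobi_symm y (polarJacobi J a c a) b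
    rw [← h2, ha, hb] at h3
    simp only [map_smul, LinearMap.smul_apply, smul_eq_mul, M.form_symm b] at h3
    have h4 : (l - m) * B (polarJacobi J a c a) b = 0 := by linarith
    rw [h1, (mul_eq_zero.1 h4).resolve_left (sub_ne_zero.2 hml.symm), neg_zero]
  have hy0 : B (J a b) y = 0 := by
    rw [M.jacobi_symm, M.jacobi_duality hJ hy ha hl]
    simp [M.form_symm y b, hby]
  refine M.ext_form fun w => ?_
  have h := horth (w - (B w y / B y y) • y) (by
    simp only [map_sub, map_smul, LinearMap.sub_apply, LinearMap.smul_apply, smul_eq_mul]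
    field_simp; ring)
  simpa [hy0] using h

theorem jacobi_apply_eq_zero' (M : IsRiemannianModel B R J) (hJ : IsOrthogonallyJacobiTsankov B J)
    {y a b : V} {l m : ℝ} (hy : y ≠ 0) (ha0 : a ≠ 0) (ha : J y a = l • a) (hl : l ≠ 0)
    (hb : J y b = m • b) (hml : m ≠ l) (hby : B b y = 0) : J y b = 0 := by
  have hA := M.form_pos a ha0
  have hY := M.form_pos y hy
  refine M.jacobi_apply_eq_zero hJ ha0 (M.jacobi_duality hJ hy ha hl) (by positivity) (m := 0)
    ?_ (by positivity) ?_
  · rw [M.jacobi_apply_eq_zero hJ hy ha hl hb hml hby, zero_smul]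
  · rw [M.form_symm, M.form_eq_zero_of_eigen_ne ha hb hml]

/-- Every Jacobi operator has at most one nonzero eigenvalue. -/
theorem exists_jacobi_sq_eq_smul [FiniteDimensional ℝ V] (M : IsRiemannianModel B R J)
    (hJ : IsOrthogonallyJacobiTsankov B J) (y : V) :
    ∃ l : ℝ, ∀ z, J y (J y z) = l • J y z := by
  rcases eq_or_ne y 0 with rfl | hy
  · exact ⟨0, fun z => by simp [M.jacobi_zero]⟩
  obtain ⟨b, μ, hb⟩ := exists_eigenbasis_of_selfAdjoint B M.form_symm M.form_pos (J y)
    (fun x z => by rw [M.jacobi_symm, M.form_symm])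
  suffices h : ∃ l : ℝ, ∀ j, J y (J y (b j)) = l • J y (b j) by
    obtain ⟨l, hl⟩ := h
    refine ⟨l, fun z => ?_⟩
    have : (J y) ∘ₗ (J y) = l • J y := b.ext fun j => by simpa using hl j
    simpa using LinearMap.congr_fun this z
  by_cases h : ∃ i, μ i ≠ 0
  · obtain ⟨i, hi⟩ := h
    refine ⟨μ i, fun j => ?_⟩
    by_cases hj : μ j = μ i
    · rw [hb, map_smul, hb, hj]
    · by_cases hj0 : μ j = 0
      · simp [hb, hj0]
      · rw [M.jacobi_apply_eq_zero' hJ hy (b.ne_zero i) (hb i) hi (hb j) hj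
          (M.form_eq_zero_of_eigen (hb j) hj0)]
        simp
  · push Not at h
    exact ⟨0, fun j => by simp [hb, h]⟩

theorem eigenvalue_eq_of_jacobi_sq {y a : V} {l s : ℝ} (ha0 : a ≠ 0) (ha : J y a = l • a)
    (hl : l ≠ 0) (hs : ∀ z, J y (J y z) = s • J y z) : s = l := by
  have h := hs a
  rw [ha, map_smul, ha, smul_smul, smul_smul] at h
  exact (mul_right_cancel₀ hl (smul_left_injective ℝ ha0 h)).symm

/-- If `a ⊥ b` lie in the same nonzero eigenspace of `J y`, then `b` is also an eigenvector
of `J a`, with the eigenvalue rescaled. -/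
theorem jacobi_apply_of_eigen [FiniteDimensional ℝ V] (M : IsRiemannianModel B R J)
    (hJ : IsOrthogonallyJacobiTsankov B J) {y a b : V} {l : ℝ} (hy : y ≠ 0) (ha0 : a ≠ 0)
    (hl : l ≠ 0) (ha : J y a = l • a) (hb : J y b = l • b) (hba : B b a = 0) :
    J a b = (l * B a a / B y y) • b := by
  have hA := M.form_pos a ha0
  have hY := M.form_pos y hy
  have hay := M.form_eq_zero_of_eigen ha hl
  have hn : l * B a a / B y y ≠ 0 := by positivity
  have hdual := M.jacobi_duality hJ hy ha hl
  set n := l * B a a / B y y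
  obtain ⟨s, hs⟩ := M.exists_jacobi_sq_eq_smul hJ a
  rw [eigenvalue_eq_of_jacobi_sq hy hdual hn hs] at hs
  have hker : J a (b - n⁻¹ • J a b) = (0 : ℝ) • (b - n⁻¹ • J a b) := by
    rw [map_sub, map_smul, hs, smul_smul, inv_mul_cancel₀ hn]; simp
  have hfa : B (b - n⁻¹ • J a b) a = 0 := by
    simp [hba, M.jacobi_symm a b a, M.jacobi_self]
  have h := M.jacobi_apply_eq_zero hJ ha0 hdual hn hker hn.symm hfa
  rw [map_sub, map_smul, ← jacobi_comm hJ hay, hb, map_smul, smul_comm, ← smul_sub] at h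
  have h' := sub_eq_zero.1 ((smul_eq_zero.1 h).resolve_left hl)
  conv_rhs => rw [h', smul_smul, mul_inv_cancel₀ hn, one_smul]

theorem eq_zero_of_jacobi_eq_zero [FiniteDimensional ℝ V] (M : IsRiemannianModel B R J)
    (hJ : IsOrthogonallyJacobiTsankov B J) {y a b v : V} {l : ℝ} (hy : y ≠ 0) (ha0 : a ≠ 0)
    (hb0 : b ≠ 0) (hl : l ≠ 0) (ha : J y a = l • a) (hb : J y b = l • b) (hab : B a b = 0)
    (hv : J y v = 0) (hvy : B v y = 0) : v = 0 := by
  have hA := M.form_pos a ha0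
  have hB := M.form_pos b hb0
  have hY := M.form_pos y hy
  have hba : B b a = 0 := by rw [M.form_symm, hab]
  have hay := M.form_eq_zero_of_eigen ha hl
  have hby := M.form_eq_zero_of_eigen hb hl
  have hv0 : J y v = (0 : ℝ) • v := by rw [hv, zero_smul]
  have hav : J a v = 0 := M.jacobi_apply_eq_zero hJ hy ha hl hv0 hl.symm hvy
  have hva : B (y + v) a = 0 := by
    rw [map_add, LinearMap.add_apply, M.form_symm y a, hay, M.form_symm v a,
      M.form_eq_zero_of_eigen_ne ha hv0 hl.symm, add_zero]
  have hvb : B (y + v) b = 0 := by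
    rw [map_add, LinearMap.add_apply, M.form_symm y b, hby, M.form_symm v b,
      M.form_eq_zero_of_eigen_ne hb hv0 hl.symm, add_zero]
  have hJba := M.jacobi_apply_of_eigen hJ hy hb0 hl hb ha hab
  have hJay := M.jacobi_duality hJ hy ha hl
  have hk : l * B b b / B y y ≠ 0 := by positivity
  have hm : l * B a a / B y y ≠ 0 := by positivity
  set k := l * B b b / B y y
  set m := l * B a a / B y y
  set u := J (y + v) a with hu
  have hbu : J b u = k • u := by
    rw [hu, ← jacobi_comm hJ hvb, hJba, map_smul]
  have hau : J a u = 0 := by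
    rw [hu, ← jacobi_comm hJ hva, M.jacobi_self, map_zero]
  -- the part of `u` orthogonal to `a` is a nonzero-eigenvalue eigenvector of `J a`
  have hf : u - (B u a / B a a) • a = 0 := by
    have hf1 : J b (u - (B u a / B a a) • a) = k • (u - (B u a / B a a) • a) := by
      rw [map_sub, map_smul, hbu, hJba]; module
    have hf2 : B (u - (B u a / B a a) • a) a = 0 := by
      simp only [map_sub, map_smul, LinearMap.sub_apply, LinearMap.smul_apply, smul_eq_mul]
      field_simp; ring
    have h := M.jacobi_apply_of_eigen hJ hb0 ha0 hk hJba hf1 hf2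
    rw [map_sub, map_smul, hau, M.jacobi_self, smul_zero, sub_zero] at h
    exact (smul_eq_zero.1 h.symm).resolve_left (by positivity)
  have hJa : J a (y + v) = m • y := by rw [map_add, hav, add_zero, hJay]
  have hn : B u a ≠ 0 := by
    rw [hu, M.jacobi_swap, hJa]
    simp only [map_smul, map_add, LinearMap.smul_apply, smul_eq_mul, M.form_symm y v, hvy]
    rw [mul_zero, add_zero]; positivity
  have hx0 : y + v ≠ 0 := by
    intro h0
    rw [h0, map_zero] at hJa
    exact (smul_ne_zero hm hy) hJa.symm
  have h := M.jacobi_duality hJ hx0 (hu.symm.trans (sub_eq_zero.1 hf)) (by positivity)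
  rw [hJa] at h
  set r := B u a / B a a * B a a / B (y + v) (y + v)
  have h2 := congrArg (fun w => B w v) h
  have h3 := congrArg (fun w => B w y) h
  simp only [map_smul, map_add, LinearMap.smul_apply, LinearMap.add_apply, smul_eq_mul,
    M.form_symm y v, hvy, mul_zero, zero_add, add_zero] at h2 h3
  have hr : r ≠ 0 := by
    rintro hr
    rw [hr, zero_mul] at h3
    exact (mul_ne_zero hm hY.ne') h3
  exact M.eq_zero_of_form_self ((mul_eq_zero.1 h2.symm).resolve_left hr)

theorem jacobi_const_of_eigen_pair [FiniteDimensional ℝ V] (M : IsRiemannianModel B R J)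
    (hJ : IsOrthogonallyJacobiTsankov B J) {y a b : V} {l : ℝ} (hy : y ≠ 0) (ha0 : a ≠ 0)
    (hb0 : b ≠ 0) (hl : l ≠ 0) (ha : J y a = l • a) (hb : J y b = l • b) (hab : B a b = 0)
    (z : V) (hz : B z y = 0) : J y z = l • z := by
  obtain ⟨s, hs⟩ := M.exists_jacobi_sq_eq_smul hJ y
  rw [eigenvalue_eq_of_jacobi_sq ha0 ha hl hs] at hs
  have h := M.eq_zero_of_jacobi_eq_zero hJ (v := z - l⁻¹ • J y z) hy ha0 hb0 hl ha hb hab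
    (by rw [map_sub, map_smul, hs, smul_smul, inv_mul_cancel₀ hl]; simp)
    (by simp [hz, M.jacobi_symm y z y, M.jacobi_self])
  conv_rhs => rw [sub_eq_zero.1 h, smul_smul, mul_inv_cancel₀ hl, one_smul]

theorem jacobi_const_of_orthogonal [FiniteDimensional ℝ V] (M : IsRiemannianModel B R J)
    (hJ : IsOrthogonallyJacobiTsankov B J) {k : ℝ} (hk : k ≠ 0) {y : V} (hy : y ≠ 0)
    (h : ∀ z, B z y = 0 → J y z = (k * B y y) • z) {x : V} (hxy : B x y = 0)
    (z : V) (hz : B z x = 0) : J x z = (k * B x x) • z := by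
  rcases eq_or_ne x 0 with rfl | hx
  · simp [M.jacobi_zero]
  have hY := M.form_pos y hy
  have hl : k * B y y ≠ 0 := by positivity
  have hyx : B y x = 0 := by rw [M.form_symm, hxy]
  have h1 := M.jacobi_duality hJ hy (h x hxy) hl
  have h2 := M.jacobi_apply_of_eigen hJ (b := z - (B z y / B y y) • y) hy hx hl (h x hxy)
    (h _ (by
      simp only [map_sub, map_smul, LinearMap.sub_apply, LinearMap.smul_apply, smul_eq_mul]
      field_simp; ring)) (by simp [hz, hyx])
  have h3 : k * B y y * B x x / B y y = k * B x x := by field_simp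
  rw [h3] at h1 h2
  rw [map_sub, map_smul, h1] at h2
  linear_combination (norm := module) h2

/-- If some Jacobi operator has rank at least two, then all are those of a
constant curvature tensor. -/
theorem exists_jacobi_const [FiniteDimensional ℝ V] (M : IsRiemannianModel B R J)
    (hJ : IsOrthogonallyJacobiTsankov B J) {y a b : V} {l : ℝ} (hy : y ≠ 0) (ha0 : a ≠ 0)
    (hb0 : b ≠ 0) (hl : l ≠ 0) (ha : J y a = l • a) (hb : J y b = l • b) (hab : B a b = 0) :
    ∃ k : ℝ, ∀ x z, J x z = k • (B x x • z - B x z • x) := by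
  have hY := M.form_pos y hy
  have hA := M.form_pos a ha0
  have hk : l / B y y ≠ 0 := by positivity
  have hconst : ∀ z, B z y = 0 → J y z = (l / B y y * B y y) • z := by
    rw [div_mul_cancel₀ _ hY.ne']
    exact M.jacobi_const_of_eigen_pair hJ hy ha0 hb0 hl ha hb hab
  set k := l / B y y
  refine ⟨k, fun x z => ?_⟩
  obtain ⟨e, he0, hey, hex⟩ : ∃ e, e ≠ 0 ∧ B e y = 0 ∧ B x e = 0 := by
    have hay := M.form_eq_zero_of_eigen ha hl
    have hby := M.form_eq_zero_of_eigen hb hl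
    by_cases hxb : B x b = 0
    · exact ⟨b, hb0, hby, hxb⟩
    · refine ⟨B x b • a - B x a • b, fun h => ?_, by simp [hay, hby], ?_⟩
      · have h' := congrArg (B a) h
        simp [hab, hxb, hA.ne'] at h'
      · simp only [map_sub, map_smul, smul_eq_mul]; ring
  have he := M.jacobi_const_of_orthogonal hJ hk hy hconst hey
  have hx := M.jacobi_const_of_orthogonal hJ hk he0 he hex
  rcases eq_or_ne x 0 with rfl | hx0
  · simp [M.jacobi_zero]
  have hX := M.form_pos x hx0
  have h := hx (z - (B x z / B x x) • x) (by
    simp only [map_sub, map_smul, LinearMap.sub_apply, LinearMap.smul_apply, smul_eq_mul,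
      M.form_symm z x]
    field_simp; ring)
  rw [map_sub, map_smul, M.jacobi_self, smul_zero, sub_zero] at h
  rw [h, mul_smul, smul_sub, smul_smul, mul_div_cancel₀ _ hX.ne']

/-- If no Jacobi operator has rank two or more, they satisfy the rank one identity. -/
theorem jacobi_rank_one [FiniteDimensional ℝ V] (M : IsRiemannianModel B R J)
    (hJ : IsOrthogonallyJacobiTsankov B J)
    (hne : ∀ (y a b : V) (l : ℝ), y ≠ 0 → a ≠ 0 → l ≠ 0 → J y a = l • a →
      J y b = l • b → B a b = 0 → b = 0) (x y z : V) :
    B (J x y) y • J x z = B (J x y) z • J x y := by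
  rcases eq_or_ne x 0 with rfl | hx
  · simp [M.jacobi_zero]
  obtain ⟨l, hl⟩ := M.exists_jacobi_sq_eq_smul hJ x
  have hform : ∀ v w, B (J x v) (J x w) = l * B (J x v) w := fun v w => by
    rw [M.form_symm, M.jacobi_symm, hl, map_smul]; simp
  by_cases hu : J x y = 0
  · simp [hu]
  have hl0 : l ≠ 0 := by
    rintro rfl
    exact hu (M.eq_zero_of_form_self (by rw [hform, zero_mul]))
  refine sub_eq_zero.1 (hne x (J x y) _ l hx hu hl0 (hl y) ?_ ?_)
  · simp only [map_sub, map_smul, hl]; module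
  · simp only [map_sub, map_smul, smul_eq_mul, hform]; ring

/-- The Jacobi operators determine the curvature tensor. -/
theorem three_mul_curvature (M : IsRiemannianModel B R J) (x y z w : V) :
    3 * R x y z w = B (polarJacobi J y z x) w - B (polarJacobi J x z y) w := by
  rw [M.form_polarJacobi, M.form_polarJacobi]
  linarith [M.bianchi x y z w, M.skew y x z w, M.skew x z y w]

theorem curvature_eq_of_jacobi_const (M : IsRiemannianModel B R J) {k : ℝ}
    (h : ∀ x z, J x z = k • (B x x • z - B x z • x)) (x y z w : V) :
    R x y z w = k * (B x w * B y z - B x z * B y w) := by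
  have h3 := M.three_mul_curvature x y z w
  simp only [polarJacobi, LinearMap.sub_apply, map_sub, h, map_smul, map_add,
    LinearMap.add_apply, LinearMap.smul_apply, smul_eq_mul] at h3
  rw [M.form_symm z y, M.form_symm z x, M.form_symm y x] at h3
  linarith

/-- The operator whose value at `x` spans the range of `J x` when the Jacobi operators
have rank at most one. -/
theorem exists_linear_jacobi_eq (M : IsRiemannianModel B R J)
    (hsq : ∀ y, ∃ l : ℝ, ∀ z, J y (J y z) = l • J y z)
    (hrk : ∀ x y z, B (J x y) y • J x z = B (J x y) z • J x y) {b z : V} (hbz : J b z ≠ 0) :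
    ∃ (L : V →ₗ[ℝ] V) (c : ℝ), c ≠ 0 ∧ ∀ x z, J x z = (c * B (L x) z) • L x := by
  set a := J b z with hadef
  obtain ⟨l, hl⟩ := hsq b
  have hA := M.form_pos a hbz
  have hba : J b a = l • a := hl z
  have hl0 : l ≠ 0 := by
    rintro rfl
    refine hA.ne' ?_
    rw [hadef, M.jacobi_symm, hl z, zero_smul]; simp
  have hJb : ∀ x, B a a • J b x = (l * B a x) • a := fun x => by
    have h := hrk b a x
    simp only [hba, map_smul, LinearMap.smul_apply, smul_eq_mul] at h
    refine smul_right_injective V hl0 ?_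
    linear_combination (norm := module) h
  have hq : ∀ x, B a a * B (J x b) b = l * B a x ^ 2 := fun x => by
    have h := congrArg (fun v => B v x) (hJb x)
    simp only [map_smul, LinearMap.smul_apply, smul_eq_mul] at h
    rw [M.jacobi_swap, h]; ring
  have hker : ∀ v, B a v = 0 → J v b = 0 := fun v hv => by
    have h := hq v
    have h0 : B (J v b) b = 0 := by
      rw [hv] at h
      exact (mul_eq_zero.1 (h.trans (by ring))).resolve_left hA.ne'
    have h1 := hrk v b (J v b)
    rw [h0, zero_smul] at h1
    rcases smul_eq_zero.1 h1.symm with h2 | h2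
    · exact M.eq_zero_of_form_self h2
    · exact h2
  let L : V →ₗ[ℝ] V :=
    { toFun := fun x => B a a • polarJacobi J a x b - B a x • J a b
      map_add' := fun x y => M.ext_form fun w => by
        simp only [map_sub, map_add, map_smul, LinearMap.sub_apply, LinearMap.add_apply,
          LinearMap.smul_apply, smul_eq_mul, M.form_polarJacobi]
        ring
      map_smul' := fun t x => M.ext_form fun w => by
        simp only [map_sub, map_smul, LinearMap.sub_apply, RingHom.id_apply,
          LinearMap.smul_apply, smul_eq_mul, M.form_polarJacobi]
        ring }
  have hLdef : ∀ x, L x = B a a • polarJacobi J a x b - B a x • J a b := fun x => rfl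
  have hL : ∀ x, (B a a) ^ 2 • J x b = B a x • L x := fun x => by
    have h := hker (B a a • x + (-B a x) • a) (by
      simp only [map_add, map_smul, smul_eq_mul]; ring)
    rw [M.jacobi_add_smul, polarJacobi_comm] at h
    rw [hLdef]
    linear_combination (norm := module) h
  have hne : ∀ x z, B a x ≠ 0 → ((B a a) ^ 3 * l) • J x z = B (L x) z • L x := by
    intro x z hx
    have h := hrk x b z
    have h1 := congrArg (fun v => B v z) (hL x)
    simp only [map_smul, LinearMap.smul_apply, smul_eq_mul] at h1
    refine smul_right_injective V (pow_ne_zero 2 hx) ?_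
    calc B a x ^ 2 • ((B a a) ^ 3 * l) • J x z
        = ((B a a) ^ 3 * (l * B a x ^ 2)) • J x z := by module
      _ = (B a a) ^ 4 • (B (J x b) b • J x z) := by rw [← hq x]; module
      _ = ((B a a) ^ 2 * B (J x b) z) • ((B a a) ^ 2 • J x b) := by rw [h]; module
      _ = B a x ^ 2 • B (L x) z • L x := by rw [h1, hL]; module
  have hall : ∀ x z, ((B a a) ^ 3 * l) • J x z = B (L x) z • L x := by
    intro x z
    by_cases hx : B a x = 0
    · have hs : ∀ t : ℝ, t ≠ 0 → _ := fun t ht => hne ((1 : ℝ) • x + t • a) z (by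
        simp only [map_add, map_smul, smul_eq_mul, hx]
        simpa using ⟨ht, fun h => by simp [h] at hA⟩)
      have h1 := hs 1 one_ne_zero
      have h2 := hs (-1) (by norm_num)
      have h3 := hs 2 two_ne_zero
      simp only [M.jacobi_add_smul] at h1 h2 h3
      simp only [map_add, map_smul, LinearMap.add_apply, LinearMap.smul_apply,
        smul_eq_mul] at h1 h2 h3
      linear_combination (norm := module)
        h1 + (1 / 3 : ℝ) • h2 - (1 / 3 : ℝ) • h3
    · exact hne x z hx
  have hc : (B a a) ^ 3 * l ≠ 0 := by positivity
  refine ⟨L, ((B a a) ^ 3 * l)⁻¹, inv_ne_zero hc, fun x z => ?_⟩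
  rw [mul_smul, ← hall, smul_smul, inv_mul_cancel₀ hc, one_smul]

theorem exists_complex_structure (M : IsRiemannianModel B R J)
    (hJ : IsOrthogonallyJacobiTsankov B J) {L : V →ₗ[ℝ] V} {c : ℝ} (hc : c ≠ 0)
    (h : ∀ x z, J x z = (c * B (L x) z) • L x) (hL : L ≠ 0) :
    ∃ (k : ℝ) (Θ : V →ₗ[ℝ] V), Θ ∘ₗ Θ = -LinearMap.id ∧ (∀ x y, B (Θ x) (Θ y) = B x y) ∧
      ∀ x z, J x z = (k * B (Θ x) z) • Θ x := by
  have hself : ∀ x, B (L x) x = 0 := fun x => by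
    rcases smul_eq_zero.1 ((h x x).symm.trans (M.jacobi_self x)) with h1 | h1
    · exact (mul_eq_zero.1 h1).resolve_left hc
    · simp [h1]
  have hskew : ∀ x y, B (L x) y = -B x (L y) := fun x y => by
    have h1 := hself (x + y)
    simp only [map_add, LinearMap.add_apply, hself] at h1
    rw [M.form_symm x]; linarith
  obtain ⟨k, hk⟩ : ∃ k : ℝ, L ∘ₗ L = k • 1 := by
    refine LinearMap.exists_eq_smul_id_of_forall_notLinearIndependent fun x hx => ?_
    have hx0 : x ≠ 0 := hx.ne_zero 0
    rw [LinearIndependent.pair_iff] at hx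
    by_cases hLx : L x = 0
    · simpa using hx 0 1 (by simp [hLx])
    have hP := M.form_pos _ hLx
    have hX := M.form_pos x hx0
    have hd := M.jacobi_duality hJ hx0 (h x (L x)) (by positivity)
    have hm := (hx _ (-(c * B (L (L x)) x))
      (by rw [← hd, h, neg_smul, LinearMap.comp_apply, add_neg_cancel])).1
    exact absurd hm (by positivity)
  have hk' : ∀ x, L (L x) = k • x := fun x => by
    simpa using LinearMap.congr_fun hk x
  have hnorm : ∀ x y, B (L x) (L y) = -k * B x y := fun x y => by
    rw [hskew, hk']; simp
  obtain ⟨x, hx⟩ : ∃ x, L x ≠ 0 := by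
    by_contra! hcon
    exact hL (LinearMap.ext hcon)
  have hk0 : 0 < -k := by
    have h1 := M.form_pos _ hx
    have h2 := M.form_pos x (by rintro rfl; simp at hx)
    rw [hnorm] at h1
    exact (pos_iff_pos_of_mul_pos h1).2 h2
  have hs := Real.sq_sqrt hk0.le
  have hs0 := Real.sqrt_pos.2 hk0
  set s := √(-k)
  refine ⟨c * s ^ 2, s⁻¹ • L, ?_, fun x y => ?_, fun x z => ?_⟩
  · ext x
    simp only [LinearMap.comp_apply, LinearMap.smul_apply, map_smul, hk', smul_smul,
      LinearMap.neg_apply, LinearMap.id_apply]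
    rw [show s⁻¹ * (s⁻¹ * k) = -1 by field_simp; linarith, neg_one_smul]
  · simp only [LinearMap.smul_apply, map_smul, hnorm, smul_eq_mul, ← hs]
    field_simp
  · simp only [LinearMap.smul_apply, map_smul, smul_eq_mul, smul_smul, h]
    congr 1
    field_simp

theorem skew_of_complex_structure (M : IsRiemannianModel B R J) {Θ : V →ₗ[ℝ] V}
    (hsq : Θ ∘ₗ Θ = -LinearMap.id) (hherm : ∀ x y, B (Θ x) (Θ y) = B x y) (x y : V) :
    B (Θ x) y = -B (Θ y) x := by
  have h1 : Θ (Θ y) = -y := by simpa using LinearMap.congr_fun hsq y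
  have h2 := hherm x (Θ y)
  rw [h1, map_neg] at h2
  rw [M.form_symm (Θ y), ← h2, neg_neg]

theorem curvature_eq_of_jacobi_complex (M : IsRiemannianModel B R J) {k : ℝ} {Θ : V →ₗ[ℝ] V}
    (hsq : Θ ∘ₗ Θ = -LinearMap.id) (hherm : ∀ x y, B (Θ x) (Θ y) = B x y)
    (h : ∀ x z, J x z = (k * B (Θ x) z) • Θ x) (x y z w : V) :
    R x y z w = k / 3 * (B (Θ y) z * B (Θ x) w - B (Θ x) z * B (Θ y) w
      - 2 * B (Θ x) y * B (Θ z) w) := by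
  have h3 := M.three_mul_curvature x y z w
  have hskew := M.skew_of_complex_structure hsq hherm
  simp only [polarJacobi, LinearMap.sub_apply, map_sub, h, map_smul, map_add,
    LinearMap.add_apply, LinearMap.smul_apply, smul_eq_mul] at h3
  rw [hskew z y, hskew z x, hskew y x] at h3
  linarith

end IsRiemannianModel

theorem even_finrank_of_sq_eq_neg_id {V : Type*} [AddCommGroup V] [Module ℝ V]
    {Θ : V →ₗ[ℝ] V} (h : Θ ∘ₗ Θ = -LinearMap.id) : Even (Module.finrank ℝ V) := by
  have h1 := congrArg LinearMap.det h
  rw [LinearMap.det_comp, ← neg_one_smul ℝ LinearMap.id, LinearMap.det_smul, LinearMap.det_id,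
    mul_one] at h1
  by_contra hodd
  rw [(Nat.not_even_iff_odd.1 hodd).neg_one_pow] at h1
  nlinarith [mul_self_nonneg (LinearMap.det Θ)]

/-- A Riemannian model is orthogonally Jacobi–Tsankov iff either it has
constant sectional curvature (R = R_c) or dim V is even and R = c·R_Θ for a Hermitian
almost complex structure Θ. -/
theorem stmt2 {V : Type*} [AddCommGroup V] [Module ℝ V] [FiniteDimensional ℝ V]
    (B : V →ₗ[ℝ] V →ₗ[ℝ] ℝ)
    (hBsymm : ∀ x y, B x y = B y x)
    (hBpos : ∀ x, x ≠ 0 → 0 < B x x)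
    (R : V →ₗ[ℝ] V →ₗ[ℝ] V →ₗ[ℝ] V →ₗ[ℝ] ℝ)
    (hR1 : ∀ x y z w, R x y z w = -R y x z w)
    (hR2 : ∀ x y z w, R x y z w = R z w x y)
    (hR3 : ∀ x y z w, R x y z w + R y z x w + R z x y w = 0)
    (J : V → V →ₗ[ℝ] V)
    (hJ : ∀ x y z, B (J x y) z = R y x x z) :
    (∀ x y, B x y = 0 → (J x) ∘ₗ (J y) = (J y) ∘ₗ (J x)) ↔
    ((∃ c : ℝ, ∀ x y z w, R x y z w = c * (B x w * B y z - B x z * B y w)) ∨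
     (Even (Module.finrank ℝ V) ∧ ∃ (c : ℝ) (Θ : V →ₗ[ℝ] V),
       Θ ∘ₗ Θ = -LinearMap.id ∧ (∀ x y, B (Θ x) (Θ y) = B x y) ∧
       ∀ x y z w, R x y z w =
         c * (B (Θ y) z * B (Θ x) w - B (Θ x) z * B (Θ y) w - 2 * B (Θ x) y * B (Θ z) w))) := by
  have M : IsRiemannianModel B R J := ⟨hBsymm, hBpos, hR1, hR2, hR3, hJ⟩
  constructor
  · intro hT
    have hT' : IsOrthogonallyJacobiTsankov B J := hT
    by_cases hne : ∀ (y a b : V) (l : ℝ), y ≠ 0 → a ≠ 0 → l ≠ 0 → J y a = l • a →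
        J y b = l • b → B a b = 0 → b = 0
    · by_cases hflat : ∀ x z, J x z = 0
      · exact Or.inl ⟨0, M.curvature_eq_of_jacobi_const fun x z => by simp [hflat]⟩
      · push Not at hflat
        obtain ⟨b, z, hbz⟩ := hflat
        obtain ⟨L, c, hc, hL⟩ :=
          M.exists_linear_jacobi_eq (M.exists_jacobi_sq_eq_smul hT') (M.jacobi_rank_one hT' hne) hbz
        obtain ⟨k, Θ, hsq, hherm, hΘ⟩ := M.exists_complex_structure hT' hc hL (by
          rintro rfl
          exact hbz (by simp [hL]))
        exact Or.inr ⟨even_finrank_of_sq_eq_neg_id hsq, k / 3, Θ, hsq, hherm,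
          M.curvature_eq_of_jacobi_complex hsq hherm hΘ⟩
    · push Not at hne
      obtain ⟨y, a, b, l, hy, ha0, hl, ha, hb, hab, hb0⟩ := hne
      obtain ⟨k, hk⟩ := M.exists_jacobi_const hT' hy ha0 hb0 hl ha hb hab
      exact Or.inl ⟨k, M.curvature_eq_of_jacobi_const hk⟩
  · rintro (⟨c, hc⟩ | ⟨-, c, Θ, hsq, hherm, hc⟩) x y hxy
    · have hJ' : ∀ x z, J x z = c • (B x x • z - B x z • x) := fun x z =>
        M.ext_form fun w => by
          simp only [hJ, hc, map_smul, map_sub, LinearMap.smul_apply, LinearMap.sub_apply,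
            smul_eq_mul, hBsymm z x]
          ring
      ext z
      simp only [LinearMap.comp_apply, hJ', map_smul, map_sub, smul_eq_mul, hxy, hBsymm y x]
      module
    · have hskew := M.skew_of_complex_structure hsq hherm
      have hJ' : ∀ x z, J x z = (3 * c * B (Θ x) z) • Θ x := fun x z =>
        M.ext_form fun w => by
          have h0 : B (Θ x) x = 0 := by linarith [hskew x x]
          simp only [hJ, hc, map_smul, LinearMap.smul_apply, smul_eq_mul, hskew z x, h0]
          ring
      ext z
      simp [hJ', hherm, hxy, hBsymm y x]
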